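/- Let h be a holomorphic function on the unit disk 𝔻 with ∫_𝔻 |h|^2 dA < ∞. Then for every z ∈ 𝔻, the principal value integral (1/π) PV ∫_𝔻 conj(h(w)) / (w - z)^2 dA(w) equals 0, where PV means the limit as ε → 0 of the integral over 𝔻 \ {|w - z| ≤ ε}. -/

import Mathlib

open Complex Filter MeasureTheory Real

/-- The map sending each circle `‖u‖ = r` to the circle of radius `r` centred at `a * (1 - r)`. -/
noncomputable def circleShift (a u : ℂ) : ℂ := u + a * (1 - ‖u‖)

theorem norm_add_mul_sub_norm_le (a u : ℂ) (ρ : ℝ) :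
    |‖u + a * (ρ - ‖u‖)‖ - ‖u‖| ≤ ‖a‖ * |ρ - ‖u‖| := by
  have h := abs_norm_sub_norm_le (u + a * (ρ - ‖u‖)) u
  rwa [add_sub_cancel_left, norm_mul, ← ofReal_sub, norm_real, Real.norm_eq_abs, ofReal_sub] at h

theorem norm_add_mul_sub_norm_lt_iff {a : ℂ} (ha : ‖a‖ < 1) (u : ℂ) (ρ : ℝ) :
    ‖u + a * (ρ - ‖u‖)‖ < ρ ↔ ‖u‖ < ρ := by
  have h := abs_le.1 (norm_add_mul_sub_norm_le a u ρ)
  constructor <;> intro h1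
  · by_contra! h2
    rw [abs_of_nonpos (by linarith)] at h
    nlinarith
  · rw [abs_of_pos (by linarith)] at h
    nlinarith

theorem lt_norm_add_mul_sub_norm_iff {a : ℂ} (ha : ‖a‖ < 1) (u : ℂ) (ρ : ℝ) :
    ρ < ‖u + a * (ρ - ‖u‖)‖ ↔ ρ < ‖u‖ := by
  have h := abs_le.1 (norm_add_mul_sub_norm_le a u ρ)
  constructor <;> intro h1
  · by_contra! h2
    rw [abs_of_nonneg (by linarith)] at h
    nlinarith
  · rw [abs_of_neg (by linarith)] at h
    nlinarith

theorem circleShift_injective {a : ℂ} (ha : ‖a‖ < 1) : Function.Injective (circleShift a) := by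
  intro u v huv
  have h1 : u - v = a * ((‖u‖ - ‖v‖ : ℝ) : ℂ) := by
    simp only [circleShift] at huv
    push_cast
    linear_combination huv
  have h2 : ‖u - v‖ ≤ ‖a‖ * ‖u - v‖ := by
    calc ‖u - v‖ = ‖a‖ * |‖u‖ - ‖v‖| := by
          rw [h1, norm_mul, norm_real, Real.norm_eq_abs]
      _ ≤ ‖a‖ * ‖u - v‖ := by gcongr; exact abs_norm_sub_norm_le u v
  have h3 : ‖u - v‖ = 0 := by nlinarith [norm_nonneg (u - v)]
  exact sub_eq_zero.1 (norm_eq_zero.1 h3)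

theorem circleShift_surjective {a : ℂ} (ha : ‖a‖ < 1) : Function.Surjective (circleShift a) := by
  intro w
  have hc : ContractingWith ‖a‖₊ (fun u : ℂ => w - a * (1 - ‖u‖)) := by
    refine ⟨by exact_mod_cast ha, LipschitzWith.of_dist_le_mul fun u v => ?_⟩
    have : w - a * (1 - ‖u‖) - (w - a * (1 - ‖v‖)) = a * ((‖u‖ - ‖v‖ : ℝ) : ℂ) := by
      push_cast; ring
    rw [dist_eq_norm, this, norm_mul, norm_real, Real.norm_eq_abs, dist_eq_norm, coe_nnnorm]
    gcongr
    exact abs_norm_sub_norm_le u v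
  refine ⟨hc.fixedPoint, ?_⟩
  have h : w - a * (1 - ‖hc.fixedPoint‖) = hc.fixedPoint := hc.fixedPoint_isFixedPt
  simp only [circleShift]
  linear_combination -h

theorem circleShift_image_annulus {a : ℂ} (ha : ‖a‖ < 1) (ε : ℝ) :
    circleShift a '' {u | ε < ‖u‖ ∧ ‖u‖ < 1} =
      {w | w ∈ Metric.ball (0 : ℂ) 1 ∧ ε < dist w (a * (1 - ε))} := by
  have key (u : ℂ) : (circleShift a u ∈ Metric.ball (0 : ℂ) 1 ∧
      ε < dist (circleShift a u) (a * (1 - ε))) ↔ ε < ‖u‖ ∧ ‖u‖ < 1 := by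
    have h1 := norm_add_mul_sub_norm_lt_iff ha u 1
    have h2 := lt_norm_add_mul_sub_norm_iff ha u ε
    have h3 : circleShift a u - a * (1 - ε) = u + a * (ε - ‖u‖) := by
      simp only [circleShift]; ring
    rw [mem_ball_zero_iff, dist_eq_norm, h3, h2, and_comm]
    exact and_congr_right fun _ => by simpa [circleShift] using h1
  ext w
  obtain ⟨u, rfl⟩ := circleShift_surjective ha w
  rw [(circleShift_injective ha).mem_set_image]
  exact (key u).symm

theorem hasFDerivAt_circleShift (a : ℂ) {u : ℂ} (hu : u ≠ 0) :
    HasFDerivAt (circleShift a)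
      (ContinuousLinearMap.id ℝ ℂ - (‖u‖⁻¹ • innerSL ℝ u).smulRight a) u := by
  have hn : HasFDerivAt (fun v : ℂ => ‖v‖) (‖u‖⁻¹ • innerSL ℝ u) u := by
    have h := (hasStrictFDerivAt_norm_sq u).hasFDerivAt.sqrt (by simpa using hu)
    simp only [Real.sqrt_sq (norm_nonneg _)] at h
    refine h.congr_fderiv ?_
    rw [← Nat.cast_smul_eq_nsmul ℝ, smul_smul]
    congr 1
    push_cast
    field_simp
  have hs : circleShift a = fun v => v + (1 - ‖v‖) • a := by
    ext v
    simp [circleShift, mul_comm]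
  rw [hs]
  refine ((hasFDerivAt_id u).add ((hn.const_sub 1).smul_const a)).congr_fderiv ?_
  ext v
  simp [sub_eq_add_neg]

theorem det_circleShift_deriv (a u : ℂ) :
    (ContinuousLinearMap.id ℝ ℂ - (‖u‖⁻¹ • innerSL ℝ u).smulRight a).det =
      1 - ‖u‖⁻¹ * (a * (starRingEnd ℂ) u).re := by
  rw [ContinuousLinearMap.det, ← LinearMap.det_toMatrix basisOneI, Matrix.det_fin_two]
  simp [LinearMap.toMatrix_apply]
  ring

theorem integral_circle_mul_eq_zero {g : ℂ → ℂ}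
    (hg : DifferentiableOn ℂ g (Metric.closedBall 0 1)) :
    ∫ θ in Set.Ioo (-π) π, circleMap 0 1 θ * g (circleMap 0 1 θ) = 0 := by
  have h1 : circleAverage (fun e => e * g e) 0 1 = 0 := by
    have : DiffContOnCl ℂ (fun e => e * g e) (Metric.ball 0 |1|) := by
      rw [abs_one]
      exact (differentiableOn_id.mul hg).diffContOnCl_ball subset_rfl
    simpa using this.circleAverage
  rw [circleAverage_def, smul_eq_zero_iff_right (by positivity)] at h1
  have hp : Function.Periodic (fun θ => circleMap 0 1 θ * g (circleMap 0 1 θ)) (2 * π) :=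
    fun θ => by simp only [periodic_circleMap 0 1 θ]
  have h2 := hp.intervalIntegral_add_eq (-π) 0
  rw [zero_add, h1, show -π + 2 * π = π by ring,
    intervalIntegral.integral_of_le (by linarith [pi_pos]), integral_Ioc_eq_integral_Ioo] at h2
  exact h2

theorem integral_eq_zero_of_circle_integral_eq_zero {G : ℂ → ℂ}
    (hG : ∀ r : ℝ, 0 < r → ∫ θ in Set.Ioo (-π) π, G (r * circleMap 0 1 θ) = 0) :
    ∫ u, G u = 0 := by
  rw [← Complex.integral_comp_polarCoord_symm]
  by_cases hi : IntegrableOn (fun p : ℝ × ℝ => p.1 • G (Complex.polarCoord.symm p))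
    polarCoord.target
  · rw [polarCoord_target] at hi ⊢
    rw [Measure.volume_eq_prod] at hi ⊢
    rw [setIntegral_prod _ hi]
    refine setIntegral_eq_zero_of_forall_eq_zero fun r hr => ?_
    have (θ : ℝ) : Complex.polarCoord.symm (r, θ) = r * circleMap 0 1 θ := by
      simp [circleMap, exp_mul_I]
    simp only [this, integral_smul, hG r hr, smul_zero]
  · exact integral_undef hi

theorem schiffer_circle_integral {h : ℂ → ℂ}
    (hh : DifferentiableOn ℂ h (Metric.ball (0 : ℂ) 1)) {a : ℂ} (ha : ‖a‖ < 1)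
    {ε r : ℝ} (hε : 0 < ε) (hεr : ε < r) (hr1 : r < 1) :
    ∫ θ in Set.Ioo (-π) π,
      ((1 - (a * (starRingEnd ℂ) (circleMap 0 1 θ)).re : ℝ) : ℂ) *
        ((starRingEnd ℂ) (h (circleShift a (r * circleMap 0 1 θ))) /
          (circleShift a (r * circleMap 0 1 θ) - a * (1 - ε)) ^ 2) = 0 := by
  have hr : 0 < r := hε.trans hεr
  let g : ℂ → ℂ := fun e => (e - ((starRingEnd ℂ) a * e ^ 2 + a) / 2) *
    h (a * (1 - r) + r * e) / (r + (starRingEnd ℂ) a * (ε - r) * e) ^ 2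
  have hne (e : ℂ) (he : ‖e‖ ≤ 1) : r + (starRingEnd ℂ) a * (ε - r) * e ≠ 0 := by
    intro h0
    have h1 : ‖(starRingEnd ℂ) a * ((ε - r : ℝ) : ℂ) * e‖ = r := by
      push_cast
      rw [eq_neg_of_add_eq_zero_right h0, norm_neg, norm_real, Real.norm_of_nonneg hr.le]
    rw [norm_mul, norm_mul, norm_real, RCLike.norm_conj, Real.norm_of_nonpos (by linarith)] at h1
    have h2 : ‖a‖ * -(ε - r) * ‖e‖ ≤ ‖a‖ * -(ε - r) * 1 := by
      gcongr
      exact mul_nonneg (norm_nonneg _) (by linarith)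
    nlinarith
  have hg : DifferentiableOn ℂ g (Metric.closedBall 0 1) := by
    have hmaps : Set.MapsTo (fun e : ℂ => a * (1 - r) + r * e) (Metric.closedBall 0 1)
        (Metric.ball 0 1) := by
      intro e he
      rw [mem_closedBall_zero_iff] at he
      rw [mem_ball_zero_iff]
      calc ‖a * (1 - r) + r * e‖ ≤ ‖a * ((1 - r : ℝ) : ℂ)‖ + ‖(r : ℂ) * e‖ := by
            push_cast; exact norm_add_le _ _
        _ = ‖a‖ * (1 - r) + r * ‖e‖ := by
            rw [norm_mul, norm_mul, norm_real, norm_real, Real.norm_of_nonneg hr.le,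
              Real.norm_of_nonneg (by linarith)]
        _ < 1 := by nlinarith
    refine DifferentiableOn.div (DifferentiableOn.mul (by fun_prop) ?_) (by fun_prop) ?_
    · exact hh.comp (by fun_prop) hmaps
    · intro e he
      exact pow_ne_zero 2 (hne e (mem_closedBall_zero_iff.1 he))
  have key : ∀ θ : ℝ, ((1 - (a * (starRingEnd ℂ) (circleMap 0 1 θ)).re : ℝ) : ℂ) *
        ((starRingEnd ℂ) (h (circleShift a (r * circleMap 0 1 θ))) /
          (circleShift a (r * circleMap 0 1 θ) - a * (1 - ε)) ^ 2) =
      (starRingEnd ℂ) (circleMap 0 1 θ * g (circleMap 0 1 θ)) := by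
    intro θ
    set e := circleMap 0 1 θ with he
    have hen : ‖e‖ = 1 := by simp [he]
    have hee : e * (starRingEnd ℂ) e = 1 := by rw [mul_conj, normSq_eq_norm_sq, hen]; simp
    have hru : ‖(r : ℂ) * e‖ = r := by
      rw [norm_mul, hen, norm_real, Real.norm_of_nonneg hr.le, mul_one]
    have hsh : circleShift a (r * e) = a * (1 - r) + r * e := by
      rw [circleShift, hru]; ring
    have hre : ((a * (starRingEnd ℂ) e).re : ℂ) =
        (a * (starRingEnd ℂ) e + (starRingEnd ℂ) a * e) / 2 := by
      rw [re_eq_add_conj]; simp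
    have hD := (map_ne_zero (starRingEnd ℂ)).2 (hne e hen.le)
    simp only [map_add, map_mul, map_sub, conj_ofReal, conj_conj] at hD
    have hden : (a * (1 - r) + r * e - a * (1 - ε)) =
        e * (r + a * (ε - r) * (starRingEnd ℂ) e) := by
      linear_combination (a * (r - ε)) * hee
    have he0 : e ≠ 0 := by rintro h0; simp [h0] at hen
    rw [hsh, hden]
    simp only [g, map_mul, map_div₀, map_add, map_sub, map_pow, conj_ofReal, conj_conj,
      ofReal_sub, ofReal_one, hre, map_ofNat]
    rw [mul_div_assoc', mul_div_assoc',
      div_eq_div_iff (pow_ne_zero 2 (mul_ne_zero he0 hD)) (pow_ne_zero 2 hD)]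
    generalize (starRingEnd ℂ) (h _) = H
    generalize (starRingEnd ℂ) e = c at *
    linear_combination (-(H * (r + a * (ε - r) * c) ^ 2 * ((e * c + 1) - a * c * (e * c + 1) / 2
      - (starRingEnd ℂ) a * e / 2))) * hee
  simp_rw [key]
  rw [integral_conj, integral_circle_mul_eq_zero hg, map_zero]

theorem integral_conj_div_sq_eq_zero {h : ℂ → ℂ}
    (hh : DifferentiableOn ℂ h (Metric.ball (0 : ℂ) 1)) {z : ℂ} {ε : ℝ} (hε : 0 < ε)
    (hz : ‖z‖ < 1 - ε) :
    ∫ w in {w : ℂ | w ∈ Metric.ball (0 : ℂ) 1 ∧ ε < dist w z},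
      (starRingEnd ℂ) (h w) / (w - z) ^ 2 = 0 := by
  have hpos : 0 < 1 - ε := (norm_nonneg z).trans_lt hz
  obtain ⟨a, ha, rfl⟩ : ∃ a : ℂ, ‖a‖ < 1 ∧ z = a * (1 - ε) := by
    have h0 : ((1 - ε : ℝ) : ℂ) ≠ 0 := ofReal_ne_zero.2 hpos.ne'
    refine ⟨z / (1 - ε : ℝ), ?_, ?_⟩
    · rwa [norm_div, norm_real, Real.norm_of_nonneg hpos.le, div_lt_one hpos]
    · rw [← ofReal_one, ← ofReal_sub, div_mul_cancel₀ _ h0]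
  have hmeas : MeasurableSet {u : ℂ | ε < ‖u‖ ∧ ‖u‖ < 1} :=
    (measurableSet_lt measurable_const measurable_norm).inter
      (measurableSet_lt measurable_norm measurable_const)
  rw [← circleShift_image_annulus ha, integral_image_eq_integral_abs_det_fderiv_smul volume hmeas
    (fun u hu => (hasFDerivAt_circleShift a
      (norm_pos_iff.1 (hε.trans hu.1))).hasFDerivWithinAt) (circleShift_injective ha).injOn,
    ← integral_indicator hmeas]
  refine integral_eq_zero_of_circle_integral_eq_zero fun r hr => ?_
  have hn (θ : ℝ) : ‖(r : ℂ) * circleMap 0 1 θ‖ = r := by simp [abs_of_pos hr]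
  by_cases hra : ε < r ∧ r < 1
  · refine (integral_congr_ae (ae_of_all _ fun θ => ?_)).trans
      (schiffer_circle_integral hh ha hε hra.1 hra.2)
    have hdet : 1 - ‖(r : ℂ) * circleMap 0 1 θ‖⁻¹ *
        (a * (starRingEnd ℂ) (r * circleMap 0 1 θ)).re =
        1 - (a * (starRingEnd ℂ) (circleMap 0 1 θ)).re := by
      rw [hn, map_mul, conj_ofReal, mul_left_comm, re_ofReal_mul, inv_mul_cancel_left₀ hr.ne']
    have hle : (a * (starRingEnd ℂ) (circleMap 0 1 θ)).re ≤ 1 := by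
      refine (re_le_norm _).trans ?_
      rw [norm_mul, RCLike.norm_conj]
      simpa using ha.le
    rw [Set.indicator_of_mem (by simpa only [Set.mem_ofPred_eq, hn] using hra),
      det_circleShift_deriv, hdet, abs_of_nonneg (by linarith), real_smul]
  · have (θ : ℝ) : (r : ℂ) * circleMap 0 1 θ ∉ {u : ℂ | ε < ‖u‖ ∧ ‖u‖ < 1} := by
      simpa only [Set.mem_ofPred_eq, hn] using hra
    simp only [Set.indicator_of_notMem (this _), integral_zero]

/-- Schiffer's identity on the unit disk: for `h` holomorphic and square-integrable
on `𝔻` and `z ∈ 𝔻`, the principal value integral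
`(1/π) PV ∫_𝔻 conj(h(w))/(w-z)^2 dA(w)` equals `0`. -/
theorem schiffer_identity_disk (h : ℂ → ℂ)
    (hh : DifferentiableOn ℂ h (Metric.ball (0 : ℂ) 1))
    (hint : IntegrableOn (fun w => ‖h w‖ ^ 2) (Metric.ball (0 : ℂ) 1))
    (z : ℂ) (hz : z ∈ Metric.ball (0 : ℂ) 1) :
    Tendsto (fun ε : ℝ =>
        ((π : ℂ))⁻¹ *
          ∫ w in {w : ℂ | w ∈ Metric.ball (0 : ℂ) 1 ∧ ε < dist w z},
            (starRingEnd ℂ) (h w) / (w - z) ^ 2)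
      (nhdsWithin 0 (Set.Ioi 0)) (nhds 0) := by
  rw [mem_ball_zero_iff] at hz
  refine tendsto_const_nhds.congr' ?_
  filter_upwards [Ioo_mem_nhdsGT (sub_pos.2 hz)] with ε hε
  rw [integral_conj_div_sq_eq_zero hh hε.1 (by linarith [hε.2]), mul_zero]
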